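/- For a positive real number b and a real number y > 0 with y ≠ 1, the contour integral (1/(2πi)) ∫_{b-i∞}^{b+i∞} y^s ds/s equals 1 if y > 1 and equals 0 if y < 1. -/

import Mathlib

open Filter

lemma perron_norm_aux (L x t : ℝ) :
    ‖Complex.exp (L * ((x : ℂ) + t * Complex.I))‖ = Real.exp (L * x) := by
  rw [Complex.norm_exp]; simp

lemma perron_abs_im_le (x t : ℝ) : |t| ≤ ‖(x : ℂ) + t * Complex.I‖ := by
  have := Complex.abs_im_le_norm ((x : ℂ) + t * Complex.I)
  simpa using this

lemma perron_abs_re_le (x t : ℝ) : |x| ≤ ‖(x : ℂ) + t * Complex.I‖ := by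
  have := Complex.abs_re_le_norm ((x : ℂ) + t * Complex.I)
  simpa using this

lemma perron_ne (x t : ℝ) (hx : x ≠ 0) : (x : ℂ) + t * Complex.I ≠ 0 := by
  intro h
  have := congrArg Complex.re h
  simp at this
  exact hx this

lemma perron_horiz (L b R T t : ℝ) (hL : L < 0) (hbR : b ≤ R) (hT : 0 < T) (ht : |t| = T) :
    ‖∫ x in b..R, Complex.exp (L * ((x : ℂ) + t * Complex.I)) / ((x : ℂ) + t * Complex.I)‖
      ≤ Real.exp (L * b) / (T * (-L)) := by
  have h1 : ‖∫ x in b..R, Complex.exp (L * ((x : ℂ) + t * Complex.I)) /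
      ((x : ℂ) + t * Complex.I)‖ ≤ ∫ x in b..R, Real.exp (L * x) / T := by
    apply intervalIntegral.norm_integral_le_of_norm_le hbR
    · refine Filter.Eventually.of_forall fun x _ => ?_
      rw [norm_div, perron_norm_aux]
      gcongr
      rw [← ht]
      exact perron_abs_im_le x t
    · apply Continuous.intervalIntegrable
      fun_prop
  refine h1.trans ?_
  rw [intervalIntegral.integral_div, intervalIntegral.integral_comp_mul_left _ hL.ne, integral_exp,
    smul_eq_mul]
  have e : Real.exp (L * b) / (T * (-L)) - L⁻¹ * (Real.exp (L * R) - Real.exp (L * b)) / T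
      = Real.exp (L * R) / (T * (-L)) := by
    have := hL.ne
    field_simp
    ring
  have : 0 ≤ Real.exp (L * R) / (T * (-L)) :=
    div_nonneg (Real.exp_pos _).le (mul_nonneg hT.le (by linarith))
  linarith

lemma perron_neg_bound (L b T : ℝ) (hL : L < 0) (hb : 0 < b) (hT : 0 < T) :
    ‖∫ t in (-T)..T, Complex.exp (L * ((b : ℂ) + t * Complex.I)) / ((b : ℂ) + t * Complex.I)‖
      ≤ 2 * (Real.exp (L * b) / (T * (-L))) := by
  have key : ∀ R ≥ b, ‖∫ t in (-T)..T, Complex.exp (L * ((b : ℂ) + t * Complex.I)) /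
      ((b : ℂ) + t * Complex.I)‖ ≤
      2 * (Real.exp (L * b) / (T * (-L))) + Real.exp (L * R) / b * (2 * T) := by
    intro R hR
    have H := Complex.integral_boundary_rect_eq_zero_of_differentiableOn
      (fun s : ℂ => Complex.exp (L * s) / s) (⟨b, -T⟩ : ℂ) (⟨R, T⟩ : ℂ) (by
        apply DifferentiableOn.div
        · fun_prop
        · fun_prop
        · intro s hs h0
          rw [Complex.mem_reProdIm] at hs
          have := hs.1
          simp only [Set.uIcc_of_le hR, h0, Complex.zero_re] at this
          linarith [this.1])
    simp only [smul_eq_mul] at H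
    have h1 := perron_horiz L b R T (-T) hL hR hT (by rw [abs_neg, abs_of_pos hT])
    have h2 := perron_horiz L b R T T hL hR hT (abs_of_pos hT)
    have h3 : ‖∫ t in (-T)..T, Complex.exp (L * ((R : ℂ) + t * Complex.I)) /
        ((R : ℂ) + t * Complex.I)‖ ≤ Real.exp (L * R) / b * |T - (-T)| := by
      apply intervalIntegral.norm_integral_le_of_norm_le_const
      intro t _
      rw [norm_div, perron_norm_aux]
      gcongr
      exact (hR.trans (le_abs_self R)).trans (perron_abs_re_le R t)
    rw [show T - -T = 2 * T by ring, abs_of_pos (by positivity : 0 < 2 * T)] at h3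
    set A := ∫ x in b..R, Complex.exp (L * ((x : ℂ) + (-T : ℝ) * Complex.I)) /
      ((x : ℂ) + (-T : ℝ) * Complex.I)
    set B := ∫ x in b..R, Complex.exp (L * ((x : ℂ) + T * Complex.I)) /
      ((x : ℂ) + T * Complex.I)
    set C := ∫ t in (-T)..T, Complex.exp (L * ((R : ℂ) + t * Complex.I)) /
        ((R : ℂ) + t * Complex.I)
    set D := ∫ t in (-T)..T, Complex.exp (L * ((b : ℂ) + t * Complex.I)) /
        ((b : ℂ) + t * Complex.I)
    have hD : Complex.I * D = A - B + Complex.I * C := by linear_combination -H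
    have : ‖D‖ = ‖A - B + Complex.I * C‖ := by rw [← hD]; simp
    rw [this]
    have n1 := norm_add_le (A - B) (Complex.I * C)
    have n2 := norm_sub_le A B
    have n3 : ‖Complex.I * C‖ = ‖C‖ := by simp
    linarith
  have lim : Tendsto (fun R : ℝ => 2 * (Real.exp (L * b) / (T * (-L))) +
      Real.exp (L * R) / b * (2 * T)) atTop (nhds (2 * (Real.exp (L * b) / (T * (-L))) +
      0 / b * (2 * T))) := by
    have : Tendsto (fun R : ℝ => Real.exp (L * R)) atTop (nhds 0) :=
      Real.tendsto_exp_atBot.comp (tendsto_id.const_mul_atTop_of_neg hL)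
    exact ((this.div_const b).mul_const _).const_add _
  have := ge_of_tendsto lim (eventually_atTop.2 ⟨b, key⟩)
  simpa using this

lemma perron_neg (L b : ℝ) (hL : L < 0) (hb : 0 < b) :
    Tendsto (fun T : ℝ => ∫ t in (-T)..T,
      Complex.exp (L * ((b : ℂ) + t * Complex.I)) / ((b : ℂ) + t * Complex.I)) atTop (nhds 0) := by
  refine squeeze_zero_norm' (a := fun T : ℝ => 2 * (Real.exp (L * b) / (T * (-L)))) ?_ ?_
  · filter_upwards [eventually_gt_atTop 0] with T hT
    exact perron_neg_bound L b T hL hb hT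
  · have h : Tendsto (fun T : ℝ => T * (-L)) atTop atTop :=
      tendsto_id.atTop_mul_const (by linarith)
    simpa using (h.const_div_atTop (Real.exp (L * b))).const_mul 2

lemma perron_rect (L b T : ℝ) (hL : 0 < L) (hb : 0 < b) (hT : 0 < T) :
    ‖(∫ t in (-T)..T, (Complex.exp (L * ((b : ℂ) + t * Complex.I)) - 1) /
        ((b : ℂ) + t * Complex.I)) -
      ∫ t in (-T)..T, (Complex.exp (L * (((-b : ℝ) : ℂ) + t * Complex.I)) - 1) /
        (((-b : ℝ) : ℂ) + t * Complex.I)‖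
      ≤ 2 * ((Real.exp (L * b) + 1) / T * (2 * b)) := by
  set g : ℂ → ℂ := dslope (fun s : ℂ => Complex.exp (L * s)) 0 with hg
  have gd : Differentiable ℂ g := by
    rw [← differentiableOn_univ, hg, Complex.differentiableOn_dslope univ_mem]
    fun_prop
  have ge : ∀ s : ℂ, s ≠ 0 → g s = (Complex.exp (L * s) - 1) / s := by
    intro s hs
    rw [hg, dslope_of_ne _ hs, slope_def_field]
    simp
  have H := Complex.integral_boundary_rect_eq_zero_of_differentiableOn
      g (⟨-b, -T⟩ : ℂ) (⟨b, T⟩ : ℂ) gd.differentiableOn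
  simp only [smul_eq_mul] at H
  have e : ∀ c : ℝ, c ≠ 0 → (∫ t in (-T)..T, (Complex.exp (L * ((c : ℂ) + t * Complex.I)) - 1) /
        ((c : ℂ) + t * Complex.I)) = ∫ t in (-T)..T, g ((c : ℂ) + t * Complex.I) := by
    intro c hc
    refine intervalIntegral.integral_congr fun t _ => ?_
    exact (ge _ (perron_ne c t hc)).symm
  rw [e b hb.ne', e (-b) (by linarith)]
  have h : ∀ t : ℝ, |t| = T → ‖∫ x in (-b)..b, g ((x : ℂ) + t * Complex.I)‖ ≤
      (Real.exp (L * b) + 1) / T * (2 * b) := by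
    intro t ht
    have : ‖∫ x in (-b)..b, g ((x : ℂ) + t * Complex.I)‖ ≤
      (Real.exp (L * b) + 1) / T * |b - (-b)| := by
      apply intervalIntegral.norm_integral_le_of_norm_le_const
      intro x hx
      rw [Set.uIoc_of_le (by linarith)] at hx
      have h1 := perron_abs_im_le x t
      rw [ht] at h1
      rw [ge _ (norm_pos_iff.1 (hT.trans_le h1)), norm_div]
      gcongr
      refine (norm_sub_le _ _).trans ?_
      rw [perron_norm_aux, norm_one]
      gcongr
      exact hx.2
    rwa [show b - -b = 2 * b by ring, abs_of_pos (by positivity : 0 < 2 * b)] at this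
  have h1 := h (-T) (by rw [abs_neg, abs_of_pos hT])
  have h2 := h T (abs_of_pos hT)
  set A := ∫ x in (-b)..b, g ((x : ℂ) + (-T : ℝ) * Complex.I)
  set B := ∫ x in (-b)..b, g ((x : ℂ) + T * Complex.I)
  set C := ∫ t in (-T)..T, g ((b : ℂ) + t * Complex.I)
  set D := ∫ t in (-T)..T, g (((-b : ℝ) : ℂ) + t * Complex.I)
  have hD : Complex.I * (C - D) = B - A := by linear_combination H
  have : ‖C - D‖ = ‖B - A‖ := by rw [← hD]; simp
  rw [this]
  have n2 := norm_sub_le B A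
  linarith

lemma perron_split (L b T : ℝ) (hb : 0 < b) :
    (∫ t in (-T)..T, Complex.exp (L * ((b : ℂ) + t * Complex.I)) / ((b : ℂ) + t * Complex.I)) =
    ((∫ t in (-T)..T, (Complex.exp (L * ((b : ℂ) + t * Complex.I)) - 1) /
        ((b : ℂ) + t * Complex.I)) -
      ∫ t in (-T)..T, (Complex.exp (L * (((-b : ℝ) : ℂ) + t * Complex.I)) - 1) /
        (((-b : ℝ) : ℂ) + t * Complex.I))
    - (∫ t in (-T)..T, Complex.exp (((-L : ℝ) : ℂ) * ((b : ℂ) + t * Complex.I)) /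
        ((b : ℂ) + t * Complex.I))
    + ((4 * Real.arctan (T / b) : ℝ) : ℂ) := by
  have c : ∀ c : ℝ, c ≠ 0 → ∀ f : ℝ → ℂ, Continuous f → IntervalIntegrable
      (fun t : ℝ => f t / ((c : ℂ) + t * Complex.I)) MeasureTheory.volume (-T) T := by
    intro c hc f hf
    apply Continuous.intervalIntegrable
    exact hf.div (by fun_prop) fun t => perron_ne c t hc
  have hb' : -b ≠ 0 := by linarith
  have h1 : (∫ t in (-T)..T, Complex.exp (((-L : ℝ) : ℂ) * ((b : ℂ) + t * Complex.I)) /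
        ((b : ℂ) + t * Complex.I)) = - ∫ t in (-T)..T,
        Complex.exp (L * (((-b : ℝ) : ℂ) + t * Complex.I)) /
        (((-b : ℝ) : ℂ) + t * Complex.I) := by
    rw [← intervalIntegral.integral_neg]
    have := intervalIntegral.integral_comp_neg (a := -T) (b := T)
      (fun t : ℝ => -(Complex.exp (L * (((-b : ℝ) : ℂ) + t * Complex.I)) /
        (((-b : ℝ) : ℂ) + t * Complex.I)))
    rw [neg_neg] at this
    rw [← this]
    refine intervalIntegral.integral_congr fun t _ => ?_
    rw [← div_neg]
    congr 2 <;> push_cast <;> ring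
  have h2 : (∫ t in (-T)..T, 1 / ((b : ℂ) + t * Complex.I)) -
      (∫ t in (-T)..T, 1 / (((-b : ℝ) : ℂ) + t * Complex.I)) =
      ((4 * Real.arctan (T / b) : ℝ) : ℂ) := by
    rw [← intervalIntegral.integral_sub (c b hb.ne' _ continuous_const)
      (c (-b) hb' _ continuous_const)]
    have : ∀ t : ℝ, 1 / ((b : ℂ) + t * Complex.I) - 1 / (((-b : ℝ) : ℂ) + t * Complex.I) =
        ((2 / b * (1 / (1 + (t / b) ^ 2)) : ℝ) : ℂ) := by
      intro t
      have e1 := perron_ne b t hb.ne'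
      have e2 := perron_ne (-b) t hb'
      have e3 : (b : ℂ) ≠ 0 := by exact_mod_cast hb.ne'
      have e4 : (b : ℂ) ^ 2 + (t : ℂ) ^ 2 ≠ 0 := by
        have : b ^ 2 + t ^ 2 ≠ 0 := by positivity
        exact_mod_cast this
      have e5 : 1 + ((t : ℂ) / b) ^ 2 = ((b : ℂ) ^ 2 + (t : ℂ) ^ 2) / b ^ 2 := by
        field_simp
      push_cast at e2 ⊢
      rw [e5, div_sub_div _ _ e1 e2, one_div_div, div_mul_div_comm, div_eq_div_iff
        (mul_ne_zero e1 e2) (mul_ne_zero e3 e4)]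
      linear_combination (-2 * (b : ℂ) ^ 2 * t ^ 2) * Complex.I_sq
    rw [intervalIntegral.integral_congr fun t _ => this t, intervalIntegral.integral_ofReal]
    congr 1
    rw [intervalIntegral.integral_const_mul,
      intervalIntegral.integral_comp_div (fun u : ℝ => 1 / (1 + u ^ 2)) hb.ne',
      integral_one_div_one_add_sq, neg_div, Real.arctan_neg, smul_eq_mul]
    field_simp
    ring
  simp only [sub_div]
  rw [intervalIntegral.integral_sub (c b hb.ne' _ (by fun_prop)) (c b hb.ne' _ continuous_const),
    intervalIntegral.integral_sub (c (-b) hb' _ (by fun_prop)) (c (-b) hb' _ continuous_const),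
    h1, ← h2]
  ring

lemma perron_pos (L b : ℝ) (hL : 0 < L) (hb : 0 < b) :
    Tendsto (fun T : ℝ => ∫ t in (-T)..T,
      Complex.exp (L * ((b : ℂ) + t * Complex.I)) / ((b : ℂ) + t * Complex.I)) atTop
      (nhds (2 * Real.pi)) := by
  simp only [perron_split L b _ hb]
  have t1 : Tendsto (fun T : ℝ => (∫ t in (-T)..T,
      (Complex.exp (L * ((b : ℂ) + t * Complex.I)) - 1) / ((b : ℂ) + t * Complex.I)) -
      ∫ t in (-T)..T, (Complex.exp (L * (((-b : ℝ) : ℂ) + t * Complex.I)) - 1) /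
        (((-b : ℝ) : ℂ) + t * Complex.I)) atTop (nhds 0) := by
    refine squeeze_zero_norm' (a := fun T : ℝ => 2 * ((Real.exp (L * b) + 1) / T * (2 * b))) ?_ ?_
    · filter_upwards [eventually_gt_atTop 0] with T hT
      exact perron_rect L b T hL hb hT
    · have h : Tendsto (fun T : ℝ => T) atTop atTop := tendsto_id
      simpa using ((h.const_div_atTop (Real.exp (L * b) + 1)).mul_const (2 * b)).const_mul 2
  have t2 := perron_neg (-L) b (by linarith) hb
  have t3 : Tendsto (fun T : ℝ => 4 * Real.arctan (T / b)) atTop (nhds (4 * (Real.pi / 2))) := by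
    have h : Tendsto (fun T : ℝ => T / b) atTop atTop := tendsto_id.atTop_div_const hb
    exact ((Real.tendsto_arctan_atTop.mono_right nhdsWithin_le_nhds).comp h).const_mul 4
  have t4 := (Complex.continuous_ofReal.tendsto _).comp t3
  have e : (2 * Real.pi : ℂ) = 0 - 0 + ((4 * (Real.pi / 2) : ℝ) : ℂ) := by
    push_cast
    ring
  rw [e]
  exact (t1.sub t2).add t4

/-- Perron's discontinuous integral: for `b > 0` and `y > 0`, `y ≠ 1`,
`(1/(2πi)) ∫_{b-i∞}^{b+i∞} y^s ds/s = 1` if `y > 1` and `0` if `y < 1`,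
interpreted as a principal value, parametrizing `s = b + it`. -/
theorem perron_discontinuous_integral (b : ℝ) (hb : 0 < b) (y : ℝ) (hy : 0 < y) (hy1 : y ≠ 1) :
    Tendsto (fun T : ℝ =>
      (2 * Real.pi * Complex.I)⁻¹ *
        ∫ t in (-T)..T,
          (y : ℂ) ^ ((b : ℂ) + t * Complex.I) / ((b : ℂ) + t * Complex.I) * Complex.I)
      atTop (nhds (if 1 < y then 1 else 0)) := by
  have hyc : (y : ℂ) ≠ 0 := by exact_mod_cast hy.ne'
  have hp : (Real.pi : ℂ) ≠ 0 := by exact_mod_cast Real.pi_ne_zero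
  simp only [intervalIntegral.integral_mul_const, Complex.cpow_def_of_ne_zero hyc,
    ← Complex.ofReal_log hy.le]
  split_ifs with h
  · convert ((perron_pos (Real.log y) b (Real.log_pos h) hb).mul_const Complex.I).const_mul
      (2 * Real.pi * Complex.I)⁻¹ using 2
    rw [inv_mul_cancel₀]
    simp [hp]
  · have hlt : y < 1 := lt_of_le_of_ne (not_lt.1 h) hy1
    simpa using ((perron_neg (Real.log y) b (Real.log_neg hy hlt) hb).mul_const Complex.I).const_mul
      (2 * Real.pi * Complex.I)⁻¹
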